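/- (Multivariate q-Vandermonde formula, first version.) Let n ≥ 1 and k ≥ 1 be integers, let q > 0 be real with q ≠ 1, and let x_1,…,x_{k+1} be real numbers. Then [x_1+x_2+⋯+x_{k+1}]_{n,q} = Σ [n; r_1,…,r_k]_q · q^{Σ_{j=1}^{k}(n−s_j)(x_j−r_j)} · ∏_{j=1}^{k+1}[x_j]_{r_j,q}, where the sum is over all nonnegative integers r_1,…,r_k with r_1+⋯+r_k ≤ n, s_j = r_1+⋯+r_j for j = 1,…,k, r_{k+1} = n − s_k, and q raised to a real exponent denotes the real power. -/

import Mathlib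

open Finset Filter

noncomputable def qNum (q x : ℝ) : ℝ := (1 - q ^ x) / (1 - q)

noncomputable def qFact (q x : ℝ) (r : ℕ) : ℝ :=
  ∏ i ∈ Finset.range r, qNum q (x - i)

noncomputable def qFactorial (q : ℝ) (r : ℕ) : ℝ :=
  ∏ i ∈ Finset.range r, qNum q (i + 1)

noncomputable def qBinom (q x : ℝ) (r : ℕ) : ℝ := qFact q x r / qFactorial q r

noncomputable def qMultinom {k : ℕ} (q x : ℝ) (r : Fin k → ℕ) : ℝ :=
  qFact q x (∑ i, r i) / ∏ i, qFactorial q (r i)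

theorem qNum_add {q : ℝ} (hq : 0 < q) (a b : ℝ) :
    qNum q (a + b) = qNum q a + q ^ a * qNum q b := by
  unfold qNum
  rw [Real.rpow_add hq]
  ring

theorem qNum_ne_zero {q : ℝ} (hq0 : 0 < q) (hq1 : q ≠ 1) {x : ℝ} (hx : x ≠ 0) :
    qNum q x ≠ 0 :=
  div_ne_zero (sub_ne_zero.2 fun h => hx <| by
    have := congrArg Real.log h
    rw [Real.log_one, Real.log_rpow hq0, zero_eq_mul] at this
    exact this.resolve_right (Real.log_ne_zero_of_pos_of_ne_one hq0 hq1))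
    (sub_ne_zero.2 hq1.symm)

theorem qFactorial_ne_zero {q : ℝ} (hq0 : 0 < q) (hq1 : q ≠ 1) (r : ℕ) :
    qFactorial q r ≠ 0 :=
  Finset.prod_ne_zero_iff.2 fun _ _ => qNum_ne_zero hq0 hq1 (by positivity)

theorem qFact_natCast_mul_qFactorial (q : ℝ) (r m : ℕ) :
    qFact q ((r + m : ℕ) : ℝ) r * qFactorial q m = qFactorial q (r + m) := by
  unfold qFact qFactorial
  rw [add_comm r m, Finset.prod_range_add, mul_comm]
  congr 1
  rw [← Finset.prod_range_reflect]
  refine Finset.prod_congr rfl fun i hi => ?_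
  have hi' : i + 1 ≤ r := Finset.mem_range.1 hi
  rw [Nat.sub_sub, Nat.cast_sub (by omega)]
  push_cast
  congr 1
  ring

theorem qBinom_zero (q x : ℝ) : qBinom q x 0 = 1 := by
  simp [qBinom, qFact, qFactorial]

theorem qNum_mul_qBinom_succ {q : ℝ} (hq0 : 0 < q) (hq1 : q ≠ 1) (x : ℝ) (r : ℕ) :
    qNum q (r + 1) * qBinom q x (r + 1) = qNum q (x - r) * qBinom q x r := by
  have h1 := qFactorial_ne_zero hq0 hq1 r
  have h2 : qNum q (r + 1) ≠ 0 := qNum_ne_zero hq0 hq1 (by positivity)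
  have h3 : qFactorial q (r + 1) = qFactorial q r * qNum q (r + 1) :=
    Finset.prod_range_succ _ _
  have h4 : qFact q x (r + 1) = qFact q x r * qNum q (x - r) :=
    Finset.prod_range_succ _ _
  rw [qBinom, qBinom, h3, h4]
  field_simp

/-- The `q`-Vandermonde convolution for two summands. -/
theorem qBinom_add {q : ℝ} (hq0 : 0 < q) (hq1 : q ≠ 1) (x y : ℝ) (n : ℕ) :
    qBinom q (x + y) n = ∑ p ∈ HasAntidiagonal.antidiagonal n,
      q ^ ((p.2 : ℝ) * (x - p.1)) * (qBinom q x p.1 * qBinom q y p.2) := by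
  induction n with
  | zero => simp [qBinom_zero]
  | succ n ih =>
    have h0 : qNum q 0 = 0 := by simp [qNum]
    refine mul_left_cancel₀ (qNum_ne_zero hq0 hq1 (x := (n : ℝ) + 1) (by positivity)) ?_
    have split : ∀ p ∈ HasAntidiagonal.antidiagonal (n + 1),
        qNum q ((n : ℝ) + 1) *
            (q ^ ((p.2 : ℝ) * (x - p.1)) * (qBinom q x p.1 * qBinom q y p.2)) =
          q ^ ((p.2 : ℝ) * (x - p.1)) * qBinom q x p.1 * (qNum q p.2 * qBinom q y p.2) +
          q ^ ((p.2 : ℝ) * (x - p.1) + p.2) * (qNum q p.1 * qBinom q x p.1) *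
            qBinom q y p.2 := by
      intro p hp
      have hp' : (n : ℝ) + 1 = p.2 + p.1 := by
        rw [HasAntidiagonal.mem_antidiagonal] at hp
        exact_mod_cast (by omega : n + 1 = p.2 + p.1)
      rw [hp', qNum_add hq0, Real.rpow_add hq0]
      ring
    rw [qNum_mul_qBinom_succ hq0 hq1, ih, Finset.mul_sum, Finset.mul_sum,
      Finset.sum_congr rfl split, Finset.sum_add_distrib,
      Finset.Nat.sum_antidiagonal_succ', Finset.Nat.sum_antidiagonal_succ]
    simp only [Nat.cast_zero, h0, zero_mul, mul_zero, zero_add, Nat.cast_add,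
      Nat.cast_one, qNum_mul_qBinom_succ hq0 hq1]
    rw [← Finset.sum_add_distrib]
    refine Finset.sum_congr rfl fun p hp => ?_
    have hp' : (n : ℝ) = p.1 + p.2 := by
      rw [HasAntidiagonal.mem_antidiagonal] at hp
      exact_mod_cast hp.symm
    rw [show x + y - (n : ℝ) = (x - p.1) + (y - p.2) by rw [hp']; ring, qNum_add hq0,
      show ((p.2 : ℝ) + 1) * (x - p.1) = p.2 * (x - p.1) + (x - p.1) by ring,
      show (p.2 : ℝ) * (x - (p.1 + 1)) + p.2 = p.2 * (x - p.1) by ring,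
      Real.rpow_add hq0]
    ring

/-- The exponent of `q` in the multivariate `q`-Vandermonde formula. -/
noncomputable def vandermondeExponent {k : ℕ} (n : ℕ) (x : Fin (k + 1) → ℝ)
    (r : Fin k → ℕ) : ℝ :=
  ∑ j : Fin k, ((n : ℝ) -
    ∑ i ∈ Finset.univ.filter (fun i : Fin k => (i : ℕ) ≤ (j : ℕ)), (r i : ℝ)) *
      (x j.castSucc - r j)

theorem vandermondeExponent_cons {k : ℕ} (a m : ℕ) (x : Fin (k + 2) → ℝ) (r : Fin k → ℕ) :
    vandermondeExponent (a + m) x (Fin.cons a r : Fin (k + 1) → ℕ) =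
      m * (x 0 - a) + vandermondeExponent m (fun i => x i.succ) r := by
  simp only [vandermondeExponent, Finset.sum_filter, Fin.sum_univ_succ, Fin.cons_zero,
    Fin.cons_succ, Fin.val_zero, Fin.val_succ, Fin.castSucc_zero, Fin.succ_castSucc]
  simp [add_sub_add_left_eq_sub]

/-- Tuples of natural numbers with sum at most `n`. -/
def tuplesSumLE (k n : ℕ) : Finset (Fin k → ℕ) :=
  (Fintype.piFinset fun _ : Fin k => Finset.range (n + 1)).filter (fun r => ∑ i, r i ≤ n)

theorem mem_tuplesSumLE {k n : ℕ} {r : Fin k → ℕ} : r ∈ tuplesSumLE k n ↔ ∑ i, r i ≤ n := by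
  simp only [tuplesSumLE, Finset.mem_filter, Fintype.mem_piFinset, Finset.mem_range,
    and_iff_right_iff_imp]
  exact fun h i => Nat.lt_succ_of_le
    ((Finset.single_le_sum (fun _ _ => Nat.zero_le _) (Finset.mem_univ i)).trans h)

theorem sum_tuplesSumLE_succ {M : Type*} [AddCommMonoid M] (k n : ℕ)
    (f : (Fin (k + 1) → ℕ) → M) :
    ∑ r ∈ tuplesSumLE (k + 1) n, f r =
      ∑ p ∈ HasAntidiagonal.antidiagonal n, ∑ r ∈ tuplesSumLE k p.2, f (Fin.cons p.1 r) := by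
  rw [Finset.sum_sigma']
  refine Finset.sum_nbij' (fun r => ⟨(r 0, n - r 0), Fin.tail r⟩)
    (fun p => Fin.cons p.1.1 p.2) ?_ ?_ ?_ ?_ ?_
  · intro r hr
    rw [mem_tuplesSumLE, Fin.sum_univ_succ] at hr
    simp only [Finset.mem_sigma, HasAntidiagonal.mem_antidiagonal, mem_tuplesSumLE, Fin.tail]
    omega
  · rintro ⟨⟨a, m⟩, r⟩ hr
    simp only [Finset.mem_sigma, HasAntidiagonal.mem_antidiagonal, mem_tuplesSumLE] at hr
    simp only [mem_tuplesSumLE, Fin.sum_univ_succ, Fin.cons_zero, Fin.cons_succ]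
    omega
  · intro r _
    exact Fin.cons_self_tail r
  · rintro ⟨⟨a, m⟩, r⟩ hr
    simp only [Finset.mem_sigma, HasAntidiagonal.mem_antidiagonal] at hr
    obtain rfl : m = n - a := by omega
    simp
  · intro r _
    simp

theorem qBinom_sum {q : ℝ} (hq0 : 0 < q) (hq1 : q ≠ 1) {k : ℕ} (n : ℕ)
    (x : Fin (k + 1) → ℝ) :
    qBinom q (∑ j, x j) n = ∑ r ∈ tuplesSumLE k n, q ^ vandermondeExponent n x r *
      ((∏ j : Fin k, qBinom q (x j.castSucc) (r j)) *
        qBinom q (x (Fin.last k)) (n - ∑ i, r i)) := by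
  induction k generalizing n with
  | zero =>
    have h : tuplesSumLE 0 n = {default} := by
      ext r
      simp [mem_tuplesSumLE, Subsingleton.elim r default]
    simp [h, vandermondeExponent]
  | succ k ih =>
    rw [Fin.sum_univ_succ, qBinom_add hq0 hq1, sum_tuplesSumLE_succ]
    refine Finset.sum_congr rfl fun p hp => ?_
    obtain rfl := HasAntidiagonal.mem_antidiagonal.1 hp
    rw [ih, Finset.mul_sum, Finset.mul_sum]
    refine Finset.sum_congr rfl fun r _ => ?_
    rw [vandermondeExponent_cons, Real.rpow_add hq0, Fin.prod_univ_succ, Fin.sum_univ_succ]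
    simp only [Fin.cons_zero, Fin.cons_succ, Fin.castSucc_zero, Fin.succ_castSucc,
      Fin.succ_last, Nat.add_sub_add_left]
    ring

/-- Multivariate `q`-Vandermonde formula, first version (2.7):
`[x₁+⋯+x_{k+1}]_{n,q} = ∑ [n; r₁,…,r_k]_q q^{∑_{j=1}^{k}(n−s_j)(x_j−r_j)} ∏_{j=1}^{k+1}[x_j]_{r_j,q}`,
summed over nonnegative integers `r₁,…,r_k` with `r₁+⋯+r_k ≤ n`, where `s_j = r₁+⋯+r_j`
and `r_{k+1} = n − s_k`. -/
theorem multivariate_qVandermonde_first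
    (n k : ℕ) (hn : 1 ≤ n) (hk : 1 ≤ k)
    (q : ℝ) (hq0 : 0 < q) (hq1 : q ≠ 1) (x : Fin (k + 1) → ℝ) :
    qFact q (∑ j, x j) n =
      ∑ r ∈ (Fintype.piFinset fun _ : Fin k => Finset.range (n + 1)).filter
          (fun r => ∑ i, r i ≤ n),
        qMultinom q (n : ℝ) r *
          q ^ (∑ j : Fin k,
                ((n : ℝ) -
                    ∑ i ∈ Finset.univ.filter (fun i : Fin k => (i : ℕ) ≤ (j : ℕ)), (r i : ℝ)) *
                  (x j.castSucc - r j)) *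
          ((∏ j : Fin k, qFact q (x j.castSucc) (r j)) *
            qFact q (x (Fin.last k)) (n - ∑ i, r i)) := by
  have h := congrArg (qFactorial q n * ·) (qBinom_sum hq0 hq1 n x)
  simp only [qBinom, mul_div_cancel₀ _ (qFactorial_ne_zero hq0 hq1 n), Finset.mul_sum] at h
  rw [h]
  refine Finset.sum_congr rfl fun r hr => ?_
  obtain ⟨m, hm⟩ := Nat.exists_eq_add_of_le (mem_tuplesSumLE.1 hr)
  have hf := qFact_natCast_mul_qFactorial q (∑ i, r i) m
  have hm0 := qFactorial_ne_zero hq0 hq1 m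
  have hr0 : ∏ i, qFactorial q (r i) ≠ 0 :=
    Finset.prod_ne_zero_iff.2 fun i _ => qFactorial_ne_zero hq0 hq1 (r i)
  rw [← hm] at hf
  rw [show n - ∑ i, r i = m by omega, ← hf, Finset.prod_div_distrib, qMultinom,
    vandermondeExponent]
  field_simp
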